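/- Let G be a graph, let v be a vertex of G of degree 2 with neighbours u and w, and let G' = G − v + uw be the graph obtained from G by suppressing v. Let τ be a k-tangle in G with k ≥ 3, and let τ' be the set of all oriented separations (A,B) of G' of order < k such that (A ∪ {v}, B) ∈ τ or (A, B ∪ {v}) ∈ τ. Then τ' is a k-tangle in G'. -/

import Mathlib

open Finset

variable {V : Type} [Fintype V] [DecidableEq V]

/-- `{A, B}` is a separation of the graph `G`: the two sides together cover the vertex set and
no edge of `G` joins `A \ B` to `B \ A`. -/
def IsSep (G : SimpleGraph V) (A B : Finset V) : Prop :=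
  A ∪ B = Finset.univ ∧ ∀ a ∈ A \ B, ∀ b ∈ B \ A, ¬ G.Adj a b

/-- `G[A₁] ∪ G[A₂] ∪ G[A₃] = G` for the induced subgraphs on `A₁`, `A₂`, `A₃`. -/
def CoversG (G : SimpleGraph V) (A₁ A₂ A₃ : Finset V) : Prop :=
  (∀ v : V, v ∈ A₁ ∨ v ∈ A₂ ∨ v ∈ A₃) ∧
    ∀ u v : V, G.Adj u v →
      (u ∈ A₁ ∧ v ∈ A₁) ∨ (u ∈ A₂ ∧ v ∈ A₂) ∨ (u ∈ A₃ ∧ v ∈ A₃)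

/-- `τ` is a `k`-tangle in `G`: a set of oriented separations of order `< k` containing exactly
one orientation of every separation of order `< k`, and no three of its elements have small
sides whose induced subgraphs together cover `G`. -/
def IsTangle (G : SimpleGraph V) (k : ℕ) (τ : Set (Finset V × Finset V)) : Prop :=
  (∀ p ∈ τ, IsSep G p.1 p.2 ∧ (p.1 ∩ p.2).card < k) ∧
    (∀ A B : Finset V, IsSep G A B → (A ∩ B).card < k → ((A, B) ∈ τ ↔ (B, A) ∉ τ)) ∧
    ∀ p₁ ∈ τ, ∀ p₂ ∈ τ, ∀ p₃ ∈ τ, ¬ CoversG G p₁.1 p₂.1 p₃.1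

/-- The graph `G' = G - v + uw` obtained from `G` by suppressing the degree-2 vertex `v` with
neighbours `u` and `w`. -/
def suppressedGraph (G : SimpleGraph V) (v u w : V) (hu : u ≠ v) (hw : w ≠ v) :
    SimpleGraph {x : V // x ≠ v} :=
  SimpleGraph.comap Subtype.val G ⊔
    SimpleGraph.fromEdgeSet {s((⟨u, hu⟩ : {x : V // x ≠ v}), (⟨w, hw⟩ : {x : V // x ≠ v}))}

lemma IsSep.symm {G : SimpleGraph V} {A B : Finset V}
    (h : IsSep G A B) : IsSep G B A :=
  ⟨by rw [union_comm, h.1], fun a ha b hb hab => h.2 b hb a ha hab.symm⟩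

lemma IsSep.mem_of_adj {G : SimpleGraph V} {A B : Finset V}
    (h : IsSep G A B) {a b : V} (hab : G.Adj a b) : (a ∈ A ∧ b ∈ A) ∨ (a ∈ B ∧ b ∈ B) := by
  have ha : a ∈ A ∪ B := by simp [h.1]
  have hb : b ∈ A ∪ B := by simp [h.1]
  have h₁ := h.2 a
  have h₂ := h.2 b
  have hba := hab.symm
  simp only [mem_union, mem_sdiff] at *
  grind

lemma IsTangle.univ_notMem {G : SimpleGraph V} {k : ℕ}
    {τ : Set (Finset V × Finset V)} (hτ : IsTangle G k τ) (B : Finset V) :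
    (univ, B) ∉ τ :=
  fun h => hτ.2.2 _ h _ h _ h ⟨by simp, by simp⟩

/-- A set of fewer than `k` vertices is always on the small side of a `k`-tangle. -/
lemma IsTangle.mem_of_card_lt {G : SimpleGraph V} {k : ℕ}
    {τ : Set (Finset V × Finset V)} (hτ : IsTangle G k τ) {A : Finset V} (hA : A.card < k) :
    (A, univ) ∈ τ :=
  (hτ.2.1 A univ ⟨by simp, by simp⟩ (by simpa using hA)).2 (hτ.univ_notMem A)

/-- The closed neighbourhood of a vertex of degree two is a small side of every `k`-tangle
with `k ≥ 3`. -/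
lemma IsTangle.closedNeighbor_mem {G : SimpleGraph V}
    {k : ℕ} (hk : 3 ≤ k) {v u w : V}
    (hdeg : ∀ x : V, G.Adj v x → x = u ∨ x = w)
    {τ : Set (Finset V × Finset V)} (hτ : IsTangle G k τ) :
    ({u, v, w}, univ.erase v) ∈ τ := by
  have hsep : IsSep G {u, v, w} (univ.erase v) := by
    refine ⟨by ext x; simp; tauto, fun a ha b hb hab => ?_⟩
    simp only [mem_sdiff, mem_insert, mem_singleton, mem_erase, mem_univ] at ha hb
    have := hdeg b
    grind
  have hcard : (({u, v, w} : Finset V) ∩ univ.erase v).card < k := by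
    have hsub : ({u, v, w} : Finset V) ∩ univ.erase v ⊆ {u, w} := by
      intro x; simp; tauto
    have := (card_le_card hsub).trans card_le_two
    omega
  rw [hτ.2.1 _ _ hsep hcard]
  intro h
  have h₁ : (({u, v} : Finset V), univ) ∈ τ :=
    hτ.mem_of_card_lt (lt_of_le_of_lt card_le_two (by omega))
  have h₂ : (({v, w} : Finset V), univ) ∈ τ :=
    hτ.mem_of_card_lt (lt_of_le_of_lt card_le_two (by omega))
  refine hτ.2.2 _ h _ h₁ _ h₂ ⟨fun x => ?_, fun x y hxy => ?_⟩
  · simp; tauto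
  · have hx := hdeg x
    have hy := hdeg y
    have hyx := hxy.symm
    simp only [mem_insert, mem_singleton, mem_erase, mem_univ]
    grind

/-- If both neighbours of the degree-two vertex `v` lie in `A ∩ B`, then the side to which `v` is
added does not affect the orientation. -/
lemma IsTangle.insert_left_mem_iff {G : SimpleGraph V}
    {k : ℕ} (hk : 3 ≤ k) {v u w : V}
    (hdeg : ∀ x : V, G.Adj v x → x = u ∨ x = w)
    {τ : Set (Finset V × Finset V)} (hτ : IsTangle G k τ) {A B : Finset V}
    (hvA : v ∉ A) (hvB : v ∉ B) (hu : u ∈ A ∩ B) (hw : w ∈ A ∩ B)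
    (hl : IsSep G (insert v A) B) (hr : IsSep G A (insert v B)) (hcard : (A ∩ B).card < k) :
    (insert v A, B) ∈ τ ↔ (A, insert v B) ∈ τ := by
  have hcl : (insert v A ∩ B).card < k := by rwa [insert_inter_of_notMem hvB]
  have hcr : (A ∩ insert v B).card < k := by rwa [inter_insert_of_notMem hvA]
  rw [mem_inter] at hu hw
  have hcov (x : V) : x = v ∨ x ∈ A ∨ x ∈ B := by
    have : x ∈ insert v A ∪ B := by simp [hl.1]
    simp only [mem_union, mem_insert] at this
    tauto
  constructor <;> intro h <;> by_contra h'
  · rw [hτ.2.1 _ _ hr hcr, not_not] at h'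
    refine hτ.2.2 _ h _ h' _ h' ⟨fun x => ?_, fun x y hxy => ?_⟩
    · have := hcov x
      simp only [mem_insert]
      tauto
    · have := hl.mem_of_adj hxy
      simp only [mem_insert] at this ⊢
      tauto
  · rw [hτ.2.1 _ _ hl hcl, not_not] at h'
    refine hτ.2.2 _ h _ h' _ (hτ.closedNeighbor_mem hk hdeg)
      ⟨fun x => ?_, fun x y hxy => ?_⟩
    · have := hcov x
      simp only [mem_insert, mem_singleton]
      tauto
    · have h₁ := hl.mem_of_adj hxy
      have hx := hdeg x
      have hy := hdeg y
      have hyx := hxy.symm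
      simp only [mem_insert, mem_singleton] at h₁ ⊢
      grind

lemma suppressedGraph_adj_of_adj {V : Type} {G : SimpleGraph V}
    {v u w : V} {hu : u ≠ v} {hw : w ≠ v} {x y : {x : V // x ≠ v}} (h : G.Adj x y) :
    (suppressedGraph G v u w hu hw).Adj x y :=
  Or.inl h

lemma suppressedGraph_adj_neighbors {V : Type} {G : SimpleGraph V}
    {v u w : V} (hu : u ≠ v) (hw : w ≠ v) (huw : u ≠ w) :
    (suppressedGraph G v u w hu hw).Adj ⟨u, hu⟩ ⟨w, hw⟩ :=
  Or.inr (by simp [huw])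

lemma IsSep.insert_image_left {G : SimpleGraph V}
    {v u w : V} {hu : u ≠ v} {hw : w ≠ v} (hdeg : ∀ x : V, G.Adj v x → x = u ∨ x = w)
    {A B : Finset {x : V // x ≠ v}} (h : IsSep (suppressedGraph G v u w hu hw) A B)
    (huA : ⟨u, hu⟩ ∈ A) (hwA : ⟨w, hw⟩ ∈ A) :
    IsSep G (insert v (A.image Subtype.val)) (B.image Subtype.val) := by
  refine ⟨?_, fun a ha b hb hab => ?_⟩
  · ext x
    by_cases hx : x = v
    · simp [hx]
    · have : (⟨x, hx⟩ : {x : V // x ≠ v}) ∈ A ∪ B := by simp [h.1]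
      simpa [hx] using this
  · simp only [mem_sdiff, mem_insert, mem_image, not_or] at ha hb
    obtain ⟨⟨b, hb, rfl⟩, hbv, hbA⟩ := hb
    obtain ⟨rfl | ⟨a, ha, rfl⟩, haB⟩ := ha
    · obtain hbu | hbw := hdeg _ hab
      · exact hbA ⟨_, huA, hbu.symm⟩
      · exact hbA ⟨_, hwA, hbw.symm⟩
    · exact h.2 a (mem_sdiff.2 ⟨ha, fun h' => haB ⟨a, h', rfl⟩⟩) b
        (mem_sdiff.2 ⟨hb, fun h' => hbA ⟨b, h', rfl⟩⟩) (suppressedGraph_adj_of_adj hab)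

lemma val_notMem_image {V : Type} [DecidableEq V] {v : V} (A : Finset {x : V // x ≠ v}) :
    v ∉ A.image Subtype.val := by
  simp

lemma card_image_val_inter {V : Type} [DecidableEq V] {v : V} (A B : Finset {x : V // x ≠ v}) :
    (A.image Subtype.val ∩ B.image Subtype.val).card = (A ∩ B).card := by
  rw [← image_inter _ _ Subtype.val_injective, card_image_of_injective _ Subtype.val_injective]

/-- A separation of `G` with `v` only on the left has both neighbours of `v` on the left. -/
lemma IsSep.mem_of_insert_image_left {G : SimpleGraph V}
    {v u : V} (hvu : G.Adj v u) {A B : Finset {x : V // x ≠ v}}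
    (h : IsSep G (insert v (A.image Subtype.val)) (B.image Subtype.val)) :
    (⟨u, hvu.ne'⟩ : {x : V // x ≠ v}) ∈ A := by
  have := h.mem_of_adj hvu
  have hne := hvu.ne'
  simpa [hne] using this

lemma IsTangle.mem_or_iff_of_mem_left {G : SimpleGraph V}
    {k : ℕ} (hk : 3 ≤ k) {v u w : V} (hvu : G.Adj v u) (hvw : G.Adj v w)
    (hdeg : ∀ x : V, G.Adj v x → x = u ∨ x = w)
    {τ : Set (Finset V × Finset V)} (hτ : IsTangle G k τ) {A B : Finset {x : V // x ≠ v}}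
    (h : IsSep (suppressedGraph G v u w hvu.ne' hvw.ne') A B) (hcard : (A ∩ B).card < k)
    (huA : ⟨u, hvu.ne'⟩ ∈ A) (hwA : ⟨w, hvw.ne'⟩ ∈ A) :
    ((insert v (A.image Subtype.val), B.image Subtype.val) ∈ τ ∨
      (A.image Subtype.val, insert v (B.image Subtype.val)) ∈ τ) ↔
      (insert v (A.image Subtype.val), B.image Subtype.val) ∈ τ := by
  refine or_iff_left_of_imp fun hr => ?_
  have hsep := (hτ.1 _ hr).1
  have huB := hsep.symm.mem_of_insert_image_left hvu
  have hwB := hsep.symm.mem_of_insert_image_left hvw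
  refine (hτ.insert_left_mem_iff hk hdeg (val_notMem_image A) (val_notMem_image B)
    ?_ ?_ (h.insert_image_left hdeg huA hwA) hsep ?_).2 hr
  · exact mem_inter.2 ⟨mem_image_of_mem _ huA, mem_image_of_mem _ huB⟩
  · exact mem_inter.2 ⟨mem_image_of_mem _ hwA, mem_image_of_mem _ hwB⟩
  · rwa [card_image_val_inter]

lemma IsTangle.mem_or_iff_of_mem_right {G : SimpleGraph V}
    {k : ℕ} (hk : 3 ≤ k) {v u w : V} (hvu : G.Adj v u) (hvw : G.Adj v w)
    (hdeg : ∀ x : V, G.Adj v x → x = u ∨ x = w)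
    {τ : Set (Finset V × Finset V)} (hτ : IsTangle G k τ) {A B : Finset {x : V // x ≠ v}}
    (h : IsSep (suppressedGraph G v u w hvu.ne' hvw.ne') A B) (hcard : (A ∩ B).card < k)
    (huB : ⟨u, hvu.ne'⟩ ∈ B) (hwB : ⟨w, hvw.ne'⟩ ∈ B) :
    ((insert v (A.image Subtype.val), B.image Subtype.val) ∈ τ ∨
      (A.image Subtype.val, insert v (B.image Subtype.val)) ∈ τ) ↔
      (A.image Subtype.val, insert v (B.image Subtype.val)) ∈ τ := by
  refine or_iff_right_of_imp fun hl => ?_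
  have hsep := (hτ.1 _ hl).1
  have huA := hsep.mem_of_insert_image_left hvu
  have hwA := hsep.mem_of_insert_image_left hvw
  refine (hτ.insert_left_mem_iff hk hdeg (val_notMem_image A) (val_notMem_image B)
    ?_ ?_ hsep (h.symm.insert_image_left hdeg huB hwB).symm ?_).1 hl
  · exact mem_inter.2 ⟨mem_image_of_mem _ huA, mem_image_of_mem _ huB⟩
  · exact mem_inter.2 ⟨mem_image_of_mem _ hwA, mem_image_of_mem _ hwB⟩
  · rwa [card_image_val_inter]

/-- Three small sides covering the suppressed graph cover `G` once `v` is added to a side that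
contains both of its neighbours. -/
lemma CoversG.of_suppressedGraph {V : Type} [DecidableEq V] {G : SimpleGraph V}
    {v u w : V} {hu : u ≠ v} {hw : w ≠ v} (hdeg : ∀ x : V, G.Adj v x → x = u ∨ x = w)
    {A₁ A₂ A₃ : Finset {x : V // x ≠ v}} {C₁ C₂ C₃ : Finset V}
    (h : CoversG (suppressedGraph G v u w hu hw) A₁ A₂ A₃)
    (h₁ : A₁.image Subtype.val ⊆ C₁) (h₂ : A₂.image Subtype.val ⊆ C₂)
    (h₃ : A₃.image Subtype.val ⊆ C₃)
    (hv : (v ∈ C₁ ∧ u ∈ C₁ ∧ w ∈ C₁) ∨ (v ∈ C₂ ∧ u ∈ C₂ ∧ w ∈ C₂) ∨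
      (v ∈ C₃ ∧ u ∈ C₃ ∧ w ∈ C₃)) :
    CoversG G C₁ C₂ C₃ := by
  have m₁ (x) (hx : x ∈ A₁) := h₁ (mem_image_of_mem Subtype.val hx)
  have m₂ (x) (hx : x ∈ A₂) := h₂ (mem_image_of_mem Subtype.val hx)
  have m₃ (x) (hx : x ∈ A₃) := h₃ (mem_image_of_mem Subtype.val hx)
  refine ⟨fun x => ?_, fun x y hxy => ?_⟩
  · by_cases hx : x = v
    · subst hx
      tauto
    · exact (h.1 ⟨x, hx⟩).imp (m₁ _) (Or.imp (m₂ _) (m₃ _))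
  · by_cases hx : x = v
    · subst hx
      obtain rfl | rfl := hdeg _ hxy <;> tauto
    by_cases hy : y = v
    · subst hy
      obtain rfl | rfl := hdeg _ hxy.symm <;> tauto
    exact (h.2 ⟨x, hx⟩ ⟨y, hy⟩ (suppressedGraph_adj_of_adj hxy)).imp
      (And.imp (m₁ _) (m₁ _)) (Or.imp (And.imp (m₂ _) (m₂ _)) (And.imp (m₃ _) (m₃ _)))

/-- Let `v` be a vertex of `G` of degree 2 with neighbours `u` and `w`, let `G' = G - v + uw`
be obtained by suppressing `v`, let `τ` be a `k`-tangle in `G` with `k ≥ 3`, and let `τ'` be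
the set of oriented separations `(A, B)` of `G'` of order `< k` with `(A ∪ {v}, B) ∈ τ` or
`(A, B ∪ {v}) ∈ τ`.  Then `τ'` is a `k`-tangle in `G'`. -/
theorem stmt9 (k : ℕ) (hk : 3 ≤ k) (G : SimpleGraph V) (v u w : V)
    (hvu : G.Adj v u) (hvw : G.Adj v w) (huw : u ≠ w)
    (hdeg : ∀ x : V, G.Adj v x → x = u ∨ x = w)
    (τ : Set (Finset V × Finset V)) (hτ : IsTangle G k τ) :
    IsTangle (suppressedGraph G v u w hvu.ne' hvw.ne') k
      {p : Finset {x : V // x ≠ v} × Finset {x : V // x ≠ v} |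
        IsSep (suppressedGraph G v u w hvu.ne' hvw.ne') p.1 p.2 ∧ (p.1 ∩ p.2).card < k ∧
          ((insert v (p.1.image Subtype.val), p.2.image Subtype.val) ∈ τ ∨
            (p.1.image Subtype.val, insert v (p.2.image Subtype.val)) ∈ τ)} := by
  have hadj := suppressedGraph_adj_neighbors (G := G) hvu.ne' hvw.ne' huw
  refine ⟨fun p hp => ⟨hp.1, hp.2.1⟩, fun A B hAB hcard => ?_, ?_⟩
  · have hcard' : (B ∩ A).card < k := by rwa [inter_comm]
    simp only [Set.mem_ofPred_eq, hAB, hcard, hAB.symm, hcard', true_and]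
    obtain ⟨hu, hw⟩ | ⟨hu, hw⟩ := hAB.mem_of_adj hadj
    · rw [hτ.mem_or_iff_of_mem_left hk hvu hvw hdeg hAB hcard hu hw,
        hτ.mem_or_iff_of_mem_right hk hvu hvw hdeg hAB.symm hcard' hu hw]
      refine hτ.2.1 _ _ (hAB.insert_image_left hdeg hu hw) ?_
      rwa [insert_inter_of_notMem (val_notMem_image B), card_image_val_inter]
    · rw [hτ.mem_or_iff_of_mem_right hk hvu hvw hdeg hAB hcard hu hw,
        hτ.mem_or_iff_of_mem_left hk hvu hvw hdeg hAB.symm hcard' hu hw]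
      refine hτ.2.1 _ _ (hAB.symm.insert_image_left hdeg hu hw).symm ?_
      rwa [inter_insert_of_notMem (val_notMem_image A), card_image_val_inter]
  · have lift (p : Finset {x : V // x ≠ v} × Finset {x : V // x ≠ v})
        (hp : IsSep (suppressedGraph G v u w hvu.ne' hvw.ne') p.1 p.2 ∧ (p.1 ∩ p.2).card < k ∧
          ((insert v (p.1.image Subtype.val), p.2.image Subtype.val) ∈ τ ∨
            (p.1.image Subtype.val, insert v (p.2.image Subtype.val)) ∈ τ)) :
        ∃ q ∈ τ, p.1.image Subtype.val ⊆ q.1 ∧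
          (⟨u, hvu.ne'⟩ ∈ p.1 ∧ ⟨w, hvw.ne'⟩ ∈ p.1 → v ∈ q.1 ∧ u ∈ q.1 ∧ w ∈ q.1) := by
      obtain ⟨hsep, hcard, hmem⟩ := hp
      by_cases h : ⟨u, hvu.ne'⟩ ∈ p.1 ∧ ⟨w, hvw.ne'⟩ ∈ p.1
      · rw [hτ.mem_or_iff_of_mem_left hk hvu hvw hdeg hsep hcard h.1 h.2] at hmem
        exact ⟨_, hmem, subset_insert _ _, fun _ => ⟨mem_insert_self _ _,
          mem_insert_of_mem (mem_image_of_mem Subtype.val h.1),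
          mem_insert_of_mem (mem_image_of_mem Subtype.val h.2)⟩⟩
      · obtain hmem | hmem := hmem
        · exact ⟨_, hmem, subset_insert _ _, fun h' => absurd h' h⟩
        · exact ⟨_, hmem, subset_rfl, fun h' => absurd h' h⟩
    intro p₁ hp₁ p₂ hp₂ p₃ hp₃ hcov
    obtain ⟨q₁, hq₁, hs₁, hv₁⟩ := lift p₁ hp₁
    obtain ⟨q₂, hq₂, hs₂, hv₂⟩ := lift p₂ hp₂
    obtain ⟨q₃, hq₃, hs₃, hv₃⟩ := lift p₃ hp₃
    exact hτ.2.2 _ hq₁ _ hq₂ _ hq₃ (hcov.of_suppressedGraph hdeg hs₁ hs₂ hs₃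
      ((hcov.2 _ _ hadj).imp hv₁ (Or.imp hv₂ hv₃)))
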